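/- For every point τ₀ in the upper half-plane ℍ, the four polynomial functions ℂ⁴ → ℂ given by z ↦ K(τ₀,z), z ↦ L(τ₀,z), z ↦ M(τ₀,z), z ↦ N(τ₀,z) are algebraically independent over ℂ; that is, the only polynomial P ∈ ℂ[X₁,X₂,X₃,X₄] satisfying P(K(τ₀,z), L(τ₀,z), M(τ₀,z), N(τ₀,z)) = 0 for all z ∈ ℂ⁴ is P = 0. -/

import Mathlib

open MvPolynomial Complex

/-- `I2 = z1²+z2²+z3²+z4²` as a function on ℂ⁴ -/
noncomputable def fI2 (z : Fin 4 → ℂ) : ℂ := ∑ i, z i ^ 2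

/-- `I4 = Σ_{i<j} zi²zj²` as a function on ℂ⁴ -/
noncomputable def fI4 (z : Fin 4 → ℂ) : ℂ :=
  ∑ p ∈ Finset.univ.filter (fun p : Fin 4 × Fin 4 => p.1 < p.2), z p.1 ^ 2 * z p.2 ^ 2

/-- `I6 = Σ_{i<j<k} zi²zj²zk²` as a function on ℂ⁴ -/
noncomputable def fI6 (z : Fin 4 → ℂ) : ℂ :=
  ∑ p ∈ Finset.univ.filter (fun p : Fin 4 × Fin 4 × Fin 4 => p.1 < p.2.1 ∧ p.2.1 < p.2.2),
    z p.1 ^ 2 * z p.2.1 ^ 2 * z p.2.2 ^ 2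

/-- `Ĩ4 = z1z2z3z4` as a function on ℂ⁴ -/
noncomputable def fI4t (z : Fin 4 → ℂ) : ℂ := ∏ i, z i

/-- `T1 = I4/6 − I2²/24` -/
noncomputable def fT1 (z : Fin 4 → ℂ) : ℂ := fI4 z / 6 - fI2 z ^ 2 / 24

/-- `T2 = −I4/12 − Ĩ4/2 + I2²/48` -/
noncomputable def fT2 (z : Fin 4 → ℂ) : ℂ := -fI4 z / 12 - fI4t z / 2 + fI2 z ^ 2 / 48

/-- `T3 = −I4/12 + Ĩ4/2 + I2²/48` -/
noncomputable def fT3 (z : Fin 4 → ℂ) : ℂ := -fI4 z / 12 + fI4t z / 2 + fI2 z ^ 2 / 48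

/-- `θ2(τ) = Σ_{n∈ℤ} q^{(n−1/2)²/2}`, `q = e^{2πiτ}` -/
noncomputable def theta2 (τ : ℂ) : ℂ :=
  ∑' n : ℤ, Complex.exp (Real.pi * Complex.I * τ * ((n : ℂ) - 1 / 2) ^ 2)

/-- `θ3(τ) = Σ_{n∈ℤ} q^{n²/2}` -/
noncomputable def theta3 (τ : ℂ) : ℂ :=
  ∑' n : ℤ, Complex.exp (Real.pi * Complex.I * τ * (n : ℂ) ^ 2)

/-- `θ4(τ) = Σ_{n∈ℤ} (−1)ⁿ q^{n²/2}` -/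
noncomputable def theta4 (τ : ℂ) : ℂ :=
  ∑' n : ℤ, (-1 : ℂ) ^ n * Complex.exp (Real.pi * Complex.I * τ * (n : ℂ) ^ 2)

/-- `e1 = (θ3⁴+θ4⁴)/12` -/
noncomputable def e1 (τ : ℂ) : ℂ := (theta3 τ ^ 4 + theta4 τ ^ 4) / 12

/-- `e2 = (θ2⁴−θ4⁴)/12` -/
noncomputable def e2 (τ : ℂ) : ℂ := (theta2 τ ^ 4 - theta4 τ ^ 4) / 12

/-- `e3 = (−θ2⁴−θ3⁴)/12` -/
noncomputable def e3 (τ : ℂ) : ℂ := (-theta2 τ ^ 4 - theta3 τ ^ 4) / 12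

/-- `K = I2` -/
noncomputable def Kf (_τ : ℂ) (z : Fin 4 → ℂ) : ℂ := fI2 z

/-- `L = e1·T1 + e2·T2 + e3·T3` -/
noncomputable def Lf (τ : ℂ) (z : Fin 4 → ℂ) : ℂ :=
  e1 τ * fT1 z + e2 τ * fT2 z + e3 τ * fT3 z

/-- `M = 12(e1²·T1 + e2²·T2 + e3²·T3)` -/
noncomputable def Mf (τ : ℂ) (z : Fin 4 → ℂ) : ℂ :=
  12 * (e1 τ ^ 2 * fT1 z + e2 τ ^ 2 * fT2 z + e3 τ ^ 2 * fT3 z)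

/-- `N = I6/4 − I2·I4/24 + I2³/96` -/
noncomputable def Nf (_τ : ℂ) (z : Fin 4 → ℂ) : ℂ :=
  fI6 z / 4 - fI2 z * fI4 z / 24 + fI2 z ^ 3 / 96

/-- The splitting of `ℤ × ℤ` by parity of the sum of the coordinates. -/
def evenOddEquiv : (ℤ × ℤ) ⊕ (ℤ × ℤ) ≃ ℤ × ℤ where
  toFun := Sum.elim (fun p => (p.1 + p.2, p.1 - p.2)) (fun p => (p.1 + p.2 - 1, p.1 - p.2))
  invFun p := if (p.1 + p.2) % 2 = 0 then Sum.inl ((p.1 + p.2) / 2, (p.1 - p.2) / 2)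
    else Sum.inr ((p.1 + p.2 + 1) / 2, (p.1 - p.2 + 1) / 2)
  left_inv p := by
    rcases p with ⟨a, b⟩ | ⟨a, b⟩
    · have h : (a + b + (a - b)) % 2 = 0 := by omega
      simp only [Sum.elim_inl, h, if_true, Sum.inl.injEq, Prod.mk.injEq]
      omega
    · have h : ¬ (a + b - 1 + (a - b)) % 2 = 0 := by omega
      simp only [Sum.elim_inr, h, if_false, Sum.inr.injEq, Prod.mk.injEq]
      omega
  right_inv p := by
    obtain ⟨m, n⟩ := p
    by_cases h : (m + n) % 2 = 0
    · simp only [h, if_true, Sum.elim_inl, Prod.mk.injEq]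
      omega
    · simp only [h, if_false, Sum.elim_inr, Prod.mk.injEq]
      omega

theorem tsum_mul_tsum_eq_even_add_odd {f g : ℤ → ℂ} (hf : Summable (‖f ·‖))
    (hg : Summable (‖g ·‖)) :
    (∑' m, f m) * ∑' n, g n = ∑' p : ℤ × ℤ, f (p.1 + p.2) * g (p.1 - p.2) +
      ∑' p : ℤ × ℤ, f (p.1 + p.2 - 1) * g (p.1 - p.2) := by
  have h := summable_mul_of_summable_norm hf hg
  rw [tsum_mul_tsum_of_summable_norm hf hg, ← evenOddEquiv.tsum_eq]
  have h' := evenOddEquiv.summable_iff.2 h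
  rw [Summable.tsum_sum]
  · rfl
  · exact h'.comp_injective Sum.inl_injective
  · exact h'.comp_injective Sum.inr_injective

theorem exists_quadratic_roots (s t : ℂ) : ∃ x y : ℂ, x + y = s ∧ x * y = t := by
  obtain ⟨d, hd⟩ := IsAlgClosed.exists_pow_nat_eq (s ^ 2 - 4 * t) (n := 2) (by norm_num)
  exact ⟨(s + d) / 2, (s - d) / 2, by ring, by linear_combination -hd / 4⟩

theorem exists_cubic_roots (s t u : ℂ) : ∃ x y z : ℂ, x + y + z = s ∧
    x * y + x * z + y * z = t ∧ x * y * z = u := by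
  have hdeg : (Polynomial.X ^ 3 - Polynomial.C s * Polynomial.X ^ 2 +
    Polynomial.C t * Polynomial.X - Polynomial.C u :
    Polynomial ℂ).degree = 3 := by compute_degree!
  obtain ⟨x, hx⟩ := IsAlgClosed.exists_root _ (by rw [hdeg]; norm_num)
  simp only [Polynomial.IsRoot.def, Polynomial.eval_sub, Polynomial.eval_add, Polynomial.eval_mul,
    Polynomial.eval_pow, Polynomial.eval_X, Polynomial.eval_C] at hx
  obtain ⟨y, z, h1, h2⟩ := exists_quadratic_roots (s - x) (t - x * (s - x))
  exact ⟨x, y, z, by linear_combination h1, by linear_combination x * h1 + h2,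
    by linear_combination x * h2 + hx⟩

theorem exists_quartic_roots (s t u v : ℂ) : ∃ x y z w : ℂ, x + y + z + w = s ∧
    x * y + x * z + x * w + y * z + y * w + z * w = t ∧
    x * y * z + x * y * w + x * z * w + y * z * w = u ∧ x * y * z * w = v := by
  have hdeg : (Polynomial.X ^ 4 - Polynomial.C s * Polynomial.X ^ 3 +
    Polynomial.C t * Polynomial.X ^ 2 - Polynomial.C u * Polynomial.X + Polynomial.C v :
    Polynomial ℂ).degree = 4 := by compute_degree!
  obtain ⟨x, hx⟩ := IsAlgClosed.exists_root _ (by rw [hdeg]; norm_num)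
  simp only [Polynomial.IsRoot.def, Polynomial.eval_sub, Polynomial.eval_add, Polynomial.eval_mul,
    Polynomial.eval_pow, Polynomial.eval_X, Polynomial.eval_C] at hx
  obtain ⟨y, z, w, h1, h2, h3⟩ :=
    exists_cubic_roots (s - x) (t - x * (s - x)) (u - x * (t - x * (s - x)))
  exact ⟨x, y, z, w, by linear_combination h1, by linear_combination x * h1 + h2,
    by linear_combination x * h2 + h3, by linear_combination x * h3 - hx⟩

theorem fI4_eq (z : Fin 4 → ℂ) : fI4 z = z 0 ^ 2 * z 1 ^ 2 + z 0 ^ 2 * z 2 ^ 2 +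
    z 0 ^ 2 * z 3 ^ 2 + z 1 ^ 2 * z 2 ^ 2 + z 1 ^ 2 * z 3 ^ 2 + z 2 ^ 2 * z 3 ^ 2 := by
  simp [fI4, Finset.sum_filter, Fintype.sum_prod_type, Fin.sum_univ_four]
  ring

theorem fI6_eq (z : Fin 4 → ℂ) : fI6 z = z 0 ^ 2 * z 1 ^ 2 * z 2 ^ 2 +
    z 0 ^ 2 * z 1 ^ 2 * z 3 ^ 2 + z 0 ^ 2 * z 2 ^ 2 * z 3 ^ 2 + z 1 ^ 2 * z 2 ^ 2 * z 3 ^ 2 := by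
  simp [fI6, Finset.sum_filter, Fintype.sum_prod_type, Fin.sum_univ_four]

theorem exists_invariants_eq (a b c d : ℂ) :
    ∃ z : Fin 4 → ℂ, fI2 z = a ∧ fI4 z = b ∧ fI6 z = c ∧ fI4t z = d := by
  obtain ⟨x, y, z, w, h1, h2, h3, h4⟩ := exists_quartic_roots a b c (d ^ 2)
  obtain ⟨x, rfl⟩ := IsAlgClosed.exists_pow_nat_eq x (n := 2) (by norm_num)
  obtain ⟨y, rfl⟩ := IsAlgClosed.exists_pow_nat_eq y (n := 2) (by norm_num)
  obtain ⟨z, rfl⟩ := IsAlgClosed.exists_pow_nat_eq z (n := 2) (by norm_num)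
  obtain ⟨w, rfl⟩ := IsAlgClosed.exists_pow_nat_eq w (n := 2) (by norm_num)
  rcases sq_eq_sq_iff_eq_or_eq_neg.1 (show (x * y * z * w) ^ 2 = d ^ 2 by
    linear_combination h4) with h | h
  · refine ⟨![x, y, z, w], ?_, ?_, ?_, ?_⟩ <;>
      simp [fI4_eq, fI6_eq, fI2, fI4t, Fin.sum_univ_four, Fin.prod_univ_four] <;> assumption
  · refine ⟨![-x, y, z, w], ?_, ?_, ?_, ?_⟩ <;>
      simp [fI4_eq, fI6_eq, fI2, fI4t, Fin.sum_univ_four, Fin.prod_univ_four] <;>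
      first | assumption | linear_combination -h

theorem exists_KLMN_eq (τ : ℂ) (h12 : e1 τ ≠ e2 τ) (h13 : e1 τ ≠ e3 τ) (h23 : e2 τ ≠ e3 τ)
    (k l m n : ℂ) :
    ∃ z : Fin 4 → ℂ, Kf τ z = k ∧ Lf τ z = l ∧ Mf τ z = m ∧ Nf τ z = n := by
  have h12 := sub_ne_zero.2 h12
  have h13 := sub_ne_zero.2 h13
  have h23 := sub_ne_zero.2 h23
  obtain ⟨t, u, h1, h2⟩ : ∃ t u : ℂ, (e2 τ - e1 τ) * t + (e3 τ - e1 τ) * u = l ∧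
      12 * ((e2 τ ^ 2 - e1 τ ^ 2) * t + (e3 τ ^ 2 - e1 τ ^ 2) * u) = m := by
    refine ⟨((e1 τ + e3 τ) * l - m / 12) / ((e1 τ - e2 τ) * (e2 τ - e3 τ)),
      (m / 12 - (e1 τ + e2 τ) * l) / ((e1 τ - e3 τ) * (e2 τ - e3 τ)), ?_, ?_⟩
    · field_simp
      ring
    · field_simp
      ring
  obtain ⟨z, h3, h4, h5, h6⟩ := exists_invariants_eq k (k ^ 2 / 4 - 6 * (t + u))
    (4 * n + k * (k ^ 2 / 4 - 6 * (t + u)) / 6 - k ^ 3 / 24) (u - t)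
  refine ⟨z, h3, ?_, ?_, ?_⟩
  · simp only [Lf, fT1, fT2, fT3, h3, h4, h6]
    linear_combination h1
  · simp only [Mf, fT1, fT2, fT3, h3, h4, h6]
    linear_combination h2
  · simp only [Nf, h3, h4, h5]
    ring

theorem summable_theta3_term {τ : ℂ} (hτ : 0 < τ.im) :
    Summable fun n : ℤ => ‖exp (Real.pi * I * τ * (n : ℂ) ^ 2)‖ := by
  refine ((summable_jacobiTheta₂_term_iff 0 τ).2 hτ).norm.congr fun n => ?_
  rw [jacobiTheta₂_term]
  ring_nf

theorem theta2_term_eq (τ : ℂ) (n : ℤ) : exp (Real.pi * I * τ * ((n : ℂ) - 1 / 2) ^ 2) =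
    exp (Real.pi * I * τ / 4) * jacobiTheta₂_term n (-τ / 2) τ := by
  rw [jacobiTheta₂_term, ← Complex.exp_add]
  ring_nf

theorem summable_theta2_term {τ : ℂ} (hτ : 0 < τ.im) :
    Summable fun n : ℤ => ‖exp (Real.pi * I * τ * ((n : ℂ) - 1 / 2) ^ 2)‖ := by
  simp_rw [theta2_term_eq]
  exact (((summable_jacobiTheta₂_term_iff _ τ).2 hτ).mul_left _).norm

theorem summable_theta4_term {τ : ℂ} (hτ : 0 < τ.im) :
    Summable fun n : ℤ => ‖(-1 : ℂ) ^ n * exp (Real.pi * I * τ * (n : ℂ) ^ 2)‖ := by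
  simpa using summable_theta3_term hτ

theorem theta2_eq_jacobiTheta₂ (τ : ℂ) :
    theta2 τ = exp (Real.pi * I * τ / 4) * jacobiTheta₂ (-τ / 2) τ := by
  simp_rw [theta2, theta2_term_eq, tsum_mul_left, jacobiTheta₂]

theorem neg_one_zpow_eq_exp (n : ℤ) : (-1 : ℂ) ^ n = exp (Real.pi * I * n) := by
  rw [← Complex.exp_pi_mul_I, ← Complex.exp_int_mul, mul_comm]

theorem theta4_eq_jacobiTheta₂ (τ : ℂ) : theta4 τ = jacobiTheta₂ (1 / 2) τ := by
  refine tsum_congr fun n => ?_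
  rw [neg_one_zpow_eq_exp, jacobiTheta₂_term, ← Complex.exp_add]
  ring_nf

theorem theta4_eq_jacobiTheta (τ : ℂ) : theta4 τ = jacobiTheta (1 + τ) := by
  refine tsum_congr fun n => ?_
  have h : (-1 : ℂ) ^ n = (-1 : ℂ) ^ (n ^ 2) := by
    rcases Int.even_or_odd n with hn | hn
    · rw [hn.neg_one_zpow, (hn.pow_of_ne_zero two_ne_zero).neg_one_zpow]
    · rw [hn.neg_one_zpow, hn.pow.neg_one_zpow]
  rw [h, neg_one_zpow_eq_exp, ← Complex.exp_add]
  push_cast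
  ring_nf

theorem im_two_mul_pos {τ : ℂ} (hτ : 0 < τ.im) : 0 < (2 * τ).im := by simpa using hτ

theorem theta3_sq {τ : ℂ} (hτ : 0 < τ.im) :
    theta3 τ ^ 2 = theta3 (2 * τ) ^ 2 + theta2 (2 * τ) ^ 2 := by
  have h3 := summable_theta3_term (im_two_mul_pos hτ)
  have h2 := summable_theta2_term (im_two_mul_pos hτ)
  simp only [sq (theta3 _), sq (theta2 _)]
  simp only [theta3, theta2]
  rw [tsum_mul_tsum_eq_even_add_odd (summable_theta3_term hτ) (summable_theta3_term hτ),
    tsum_mul_tsum_of_summable_norm h3 h3, tsum_mul_tsum_of_summable_norm h2 h2]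
  simp only [← Complex.exp_add]
  push_cast
  congr 1 <;> exact tsum_congr fun p => by ring_nf

theorem theta4_sq {τ : ℂ} (hτ : 0 < τ.im) :
    theta4 τ ^ 2 = theta3 (2 * τ) ^ 2 - theta2 (2 * τ) ^ 2 := by
  have h3 := summable_theta3_term (im_two_mul_pos hτ)
  have h2 := summable_theta2_term (im_two_mul_pos hτ)
  simp only [sq (theta3 _), sq (theta2 _), sq (theta4 _), sub_eq_add_neg]
  simp only [theta3, theta2, theta4]
  rw [tsum_mul_tsum_eq_even_add_odd (summable_theta4_term hτ) (summable_theta4_term hτ),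
    tsum_mul_tsum_of_summable_norm h3 h3, tsum_mul_tsum_of_summable_norm h2 h2, ← tsum_neg]
  congr 1 <;> refine tsum_congr fun p => ?_
  · rw [mul_mul_mul_comm, ← zpow_add₀ (by norm_num), Even.neg_one_zpow ⟨p.1, by ring⟩, one_mul]
    simp only [← Complex.exp_add]
    push_cast
    ring_nf
  · rw [mul_mul_mul_comm, ← zpow_add₀ (by norm_num), Odd.neg_one_zpow ⟨p.1 - 1, by ring⟩,
      neg_one_mul]
    simp only [← Complex.exp_add]
    push_cast
    ring_nf

theorem theta2_sq {τ : ℂ} (hτ : 0 < τ.im) :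
    theta2 τ ^ 2 = 2 * theta2 (2 * τ) * theta3 (2 * τ) := by
  have h3 := summable_theta3_term (im_two_mul_pos hτ)
  have h2 := summable_theta2_term (im_two_mul_pos hτ)
  rw [mul_assoc, two_mul]
  nth_rewrite 2 [mul_comm (theta2 _)]
  simp only [sq (theta2 _)]
  simp only [theta3, theta2]
  rw [tsum_mul_tsum_eq_even_add_odd (summable_theta2_term hτ) (summable_theta2_term hτ),
    tsum_mul_tsum_of_summable_norm h3 h2, tsum_mul_tsum_of_summable_norm h2 h3]
  simp only [← Complex.exp_add]
  push_cast
  congr 1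
  · exact tsum_congr fun p => by ring_nf
  · rw [← ((Equiv.addRight (1 : ℤ)).prodCongr (Equiv.refl ℤ)).tsum_eq]
    refine tsum_congr fun p => ?_
    simp only [Equiv.prodCongr_apply, Prod.map_fst, Prod.map_snd, Equiv.coe_addRight,
      Equiv.refl_apply]
    push_cast
    ring_nf

theorem theta3_mul_theta4 {τ : ℂ} (hτ : 0 < τ.im) : theta3 τ * theta4 τ = theta4 (2 * τ) ^ 2 := by
  have h4 := summable_theta4_term (im_two_mul_pos hτ)
  simp only [sq (theta4 _)]
  simp only [theta3, theta4]
  rw [tsum_mul_tsum_eq_even_add_odd (summable_theta3_term hτ) (summable_theta4_term hτ),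
    tsum_mul_tsum_of_summable_norm h4 h4]
  have hodd : ∑' p : ℤ × ℤ, exp (Real.pi * I * τ * ((p.1 + p.2 - 1 : ℤ) : ℂ) ^ 2) *
      ((-1 : ℂ) ^ (p.1 - p.2) * exp (Real.pi * I * τ * ((p.1 - p.2 : ℤ) : ℂ) ^ 2)) = 0 := by
    rw [← self_eq_neg, ← tsum_neg]
    nth_rewrite 1 [← ((Equiv.subLeft (1 : ℤ)).prodCongr (Equiv.refl ℤ)).tsum_eq]
    refine tsum_congr fun p => ?_
    have h : (-1 : ℂ) ^ (1 - p.1 - p.2) = -(-1 : ℂ) ^ (p.1 - p.2) := by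
      rw [show 1 - p.1 - p.2 = (p.1 - p.2) + (1 - 2 * p.1) by ring, zpow_add₀ (by norm_num),
        Odd.neg_one_zpow (n := 1 - 2 * p.1) ⟨-p.1, by ring⟩, mul_neg_one]
    simp only [Equiv.prodCongr_apply, Prod.map_fst, Prod.map_snd, Equiv.subLeft_apply,
      Equiv.refl_apply, h, mul_left_comm (exp _) _ (exp _), ← Complex.exp_add, mul_neg, neg_mul]
    push_cast
    ring_nf
  rw [hodd, add_zero]
  refine tsum_congr fun p => ?_
  have h : (-1 : ℂ) ^ p.1 * (-1 : ℂ) ^ p.2 = (-1 : ℂ) ^ (p.1 - p.2) := by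
    rw [← zpow_add₀ (by norm_num), show p.1 + p.2 = (p.1 - p.2) + 2 * p.2 by ring,
      zpow_add₀ (by norm_num), (even_two_mul p.2).neg_one_zpow, mul_one]
  rw [mul_mul_mul_comm, h, mul_left_comm, ← Complex.exp_add, ← Complex.exp_add]
  push_cast
  ring_nf

/-- Jacobi's identity for theta constants. -/
theorem theta3_pow_four {τ : ℂ} (hτ : 0 < τ.im) : theta3 τ ^ 4 = theta2 τ ^ 4 + theta4 τ ^ 4 := by
  linear_combination (theta3 τ ^ 2 + theta3 (2 * τ) ^ 2 + theta2 (2 * τ) ^ 2) * theta3_sq hτ -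
    (theta4 τ ^ 2 + theta3 (2 * τ) ^ 2 - theta2 (2 * τ) ^ 2) * theta4_sq hτ -
    (theta2 τ ^ 2 + 2 * theta2 (2 * τ) * theta3 (2 * τ)) * theta2_sq hτ

theorem jacobiTheta_ne_zero_of_one_le_im {τ : ℂ} (hτ : 1 ≤ τ.im) : jacobiTheta τ ≠ 0 := by
  intro h
  have h1 := norm_jacobiTheta_sub_one_le (zero_lt_one.trans_le hτ)
  rw [h, zero_sub, norm_neg, norm_one] at h1
  have h3 : 3 < Real.exp (Real.pi * τ.im) := by
    nlinarith [Real.add_one_le_exp (Real.pi * τ.im), Real.pi_gt_three]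
  have h4 : Real.exp (-Real.pi * τ.im) < 1 / 3 := by
    rw [neg_mul, Real.exp_neg, one_div]
    gcongr
  rw [div_mul_eq_mul_div, le_div_iff₀ (by linarith)] at h1
  linarith

theorem theta4_ne_zero {τ : ℂ} (hτ : 0 < τ.im) : theta4 τ ≠ 0 := by
  have key (n : ℕ) : ∀ τ : ℂ, 0 < τ.im → 1 ≤ 2 ^ n * τ.im → theta4 τ ≠ 0 := by
    induction n with
    | zero =>
      intro τ _ h
      rw [theta4_eq_jacobiTheta]
      exact jacobiTheta_ne_zero_of_one_le_im (by simpa using h)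
    | succ n ih =>
      intro τ hτ h h0
      refine ih (2 * τ) (im_two_mul_pos hτ) ?_ ?_
      · rw [pow_succ, mul_assoc] at h
        simpa using h
      · rw [← sq_eq_zero_iff, ← theta3_mul_theta4 hτ, h0, mul_zero]
  obtain ⟨n, hn⟩ := pow_unbounded_of_one_lt (1 / τ.im) (one_lt_two : (1 : ℝ) < 2)
  exact key n τ hτ ((div_lt_iff₀ hτ).1 hn).le

theorem theta3_ne_zero {τ : ℂ} (hτ : 0 < τ.im) : theta3 τ ≠ 0 := by
  intro h
  have h1 := theta3_mul_theta4 hτ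
  rw [h, zero_mul, eq_comm, sq_eq_zero_iff] at h1
  exact theta4_ne_zero (im_two_mul_pos hτ) h1

theorem theta2_ne_zero {τ : ℂ} (hτ : 0 < τ.im) : theta2 τ ≠ 0 := by
  have hτ0 : τ ≠ 0 := by
    rintro rfl
    simp at hτ
  have hτ' : 0 < (-1 / τ).im := by
    rw [neg_div, one_div, ← inv_neg]
    exact (UpperHalfPlane.mk τ hτ).im_inv_neg_coe_pos
  have h := theta4_ne_zero hτ'
  rw [theta4_eq_jacobiTheta₂, jacobiTheta₂_functional_equation,
    show 1 / 2 / (-1 / τ) = -τ / 2 by field_simp, show -1 / (-1 / τ) = τ by field_simp] at h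
  rw [theta2_eq_jacobiTheta₂]
  exact mul_ne_zero (Complex.exp_ne_zero _) (right_ne_zero_of_mul h)

/-- For every point `τ₀ ∈ ℍ`, the functions `z ↦ K(τ₀,z), L(τ₀,z), M(τ₀,z), N(τ₀,z)` on ℂ⁴
are algebraically independent over ℂ: the only polynomial `P` vanishing identically on them
is `P = 0`. -/
theorem stmt_0 (τ₀ : ℂ) (hτ₀ : 0 < τ₀.im) (P : MvPolynomial (Fin 4) ℂ)
    (hP : ∀ z : Fin 4 → ℂ,
      MvPolynomial.eval (fun i => ![Kf τ₀, Lf τ₀, Mf τ₀, Nf τ₀] i z) P = 0) :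
    P = 0 := by
  have h4 := theta3_pow_four hτ₀
  have h12 : e1 τ₀ ≠ e2 τ₀ := sub_ne_zero.1 <| by
    rw [show e1 τ₀ - e2 τ₀ = theta4 τ₀ ^ 4 / 4 by rw [e1, e2]; linear_combination h4 / 12]
    exact div_ne_zero (pow_ne_zero _ (theta4_ne_zero hτ₀)) (by norm_num)
  have h13 : e1 τ₀ ≠ e3 τ₀ := sub_ne_zero.1 <| by
    rw [show e1 τ₀ - e3 τ₀ = theta3 τ₀ ^ 4 / 4 by rw [e1, e3]; linear_combination -h4 / 12]
    exact div_ne_zero (pow_ne_zero _ (theta3_ne_zero hτ₀)) (by norm_num)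
  have h23 : e2 τ₀ ≠ e3 τ₀ := sub_ne_zero.1 <| by
    rw [show e2 τ₀ - e3 τ₀ = theta2 τ₀ ^ 4 / 4 by rw [e2, e3]; linear_combination h4 / 12]
    exact div_ne_zero (pow_ne_zero _ (theta2_ne_zero hτ₀)) (by norm_num)
  refine MvPolynomial.funext fun x => ?_
  obtain ⟨z, hK, hL, hM, hN⟩ := exists_KLMN_eq τ₀ h12 h13 h23 (x 0) (x 1) (x 2) (x 3)
  rw [map_zero, ← hP z]
  congr 2
  ext i
  fin_cases i
  exacts [hK.symm, hL.symm, hM.symm, hN.symm]
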